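/- arXiv:0902.1425 — 4 statements merged into one kernel-verified Lean document; each statement's English description precedes it below -/
import Mathlib

section
/- Let n > 0 be a real number. Define A = 2(n+1)/(n(n+2)) and f(x) = (A·cos²(n·x/(2(n+1))))^{1/n} for |x| < (n+1)π/n. Then for every x with |x| < (n+1)π/n, the function g := f^{n+1} satisfies g''(x) + g(x) = (1/n)·f(x). -/
/-- For `p * k = 1`, the function `u = B * cos (k x) ^ p` has first derivative
`-B * cos (k x) ^ (p - 1) * sin (k x)` wherever `cos (k x)` is positive. -/
lemma hasDerivAt_const_mul_cos_rpow {B p k x : ℝ} (hpk : p * k = 1)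
    (hx : 0 < Real.cos (k * x)) :
    HasDerivAt (fun y => B * Real.cos (k * y) ^ p)
      (-B * (Real.cos (k * x) ^ (p - 1) * Real.sin (k * x))) x := by
  have hlin : HasDerivAt (fun y : ℝ => k * y) k x := by
    simpa using (hasDerivAt_id x).const_mul k
  refine ((hlin.cos.rpow_const (p := p) (Or.inl hx.ne')).const_mul B).congr_deriv ?_
  linear_combination
    -B * Real.cos (k * x) ^ (p - 1) * Real.sin (k * x) * hpk

/-- For `p * k = 1`, the function `u = B * cos (k x) ^ p` satisfies
`u'' + u = B * (k * (p - 1)) * cos (k x) ^ (p - 2)` wherever `cos (k x)` is positive. -/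
lemma deriv_deriv_const_mul_cos_rpow_add_self {B p k x : ℝ} (hpk : p * k = 1)
    (hx : 0 < Real.cos (k * x)) :
    deriv (deriv fun y => B * Real.cos (k * y) ^ p) x + B * Real.cos (k * x) ^ p =
      B * (k * (p - 1)) * Real.cos (k * x) ^ (p - 2) := by
  have hlin : HasDerivAt (fun y : ℝ => k * y) k x := by
    simpa using (hasDerivAt_id x).const_mul k
  have hpos : ∀ᶠ y in nhds x, 0 < Real.cos (k * y) :=
    (by fun_prop : Continuous fun y : ℝ => Real.cos (k * y)).continuousAt.eventually
      (lt_mem_nhds hx)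
  have hd : deriv (fun y => B * Real.cos (k * y) ^ p) =ᶠ[nhds x]
      fun y => -B * (Real.cos (k * y) ^ (p - 1) * Real.sin (k * y)) :=
    hpos.mono fun y hy => (hasDerivAt_const_mul_cos_rpow hpk hy).deriv
  have h2 := ((hlin.cos.rpow_const (p := p - 1) (Or.inl hx.ne')).mul hlin.sin).const_mul (-B)
  have e1 : Real.cos (k * x) ^ (p - 1) = Real.cos (k * x) ^ (p - 2) * Real.cos (k * x) := by
    rw [← Real.rpow_add_one hx.ne']; ring_nf
  have e0 : Real.cos (k * x) ^ p = Real.cos (k * x) ^ (p - 2) * Real.cos (k * x) ^ 2 := by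
    rw [← Real.rpow_add_natCast hx.ne']; norm_num
  rw [hd.deriv_eq]
  refine (congrArg (· + _) h2.deriv).trans ?_
  rw [show p - 1 - 1 = p - 2 by ring, e0, e1]
  linear_combination
    B * k * (p - 1) * Real.cos (k * x) ^ (p - 2) * Real.sin_sq_add_cos_sq (k * x)
      - B * Real.cos (k * x) ^ (p - 2) * Real.cos (k * x) ^ 2 * hpk


/-- The explicit Zmitrenko–Kurdyumov profile: with `A = 2(n+1)/(n(n+2))` and
`f x = (A cos²(n x /(2(n+1))))^{1/n}`, the function `g = f^{n+1}` satisfies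
`g'' + g = (1/n) f` on `{|x| < (n+1)π/n}`. -/
theorem stmt_0 (n : ℝ) (hn : 0 < n)
    (A : ℝ) (hA : A = 2 * (n + 1) / (n * (n + 2)))
    (f g : ℝ → ℝ)
    (hf : ∀ x : ℝ, f x = (A * (Real.cos (n * x / (2 * (n + 1)))) ^ 2) ^ (1 / n))
    (hg : ∀ x : ℝ, g x = f x ^ (n + 1)) :
    ∀ x : ℝ, |x| < (n + 1) * Real.pi / n →
      deriv (deriv g) x + g x = (1 / n) * f x := by
  intro x hx
  have hn1 : 0 < n + 1 := by linarith
  have hA0 : 0 < A := by rw [hA]; positivity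
  set k := n / (2 * (n + 1)) with hk
  set p := 2 * (n + 1) / n with hp
  have hk0 : 0 < k := by positivity
  have hpk : p * k = 1 := by rw [hp, hk]; field_simp
  have hf' : ∀ y, 0 < Real.cos (k * y) →
      f y = A ^ (1 / n) * Real.cos (k * y) ^ (p - 2) := by
    intro y hy
    rw [hf, show n * y / (2 * (n + 1)) = k * y by rw [hk]; ring,
      Real.mul_rpow hA0.le (by positivity), ← Real.rpow_natCast_mul hy.le]
    congr 2
    rw [hp]; push_cast; field_simp; ring
  have hg' : ∀ y, 0 < Real.cos (k * y) →
      g y = A ^ (1 / n) * A * Real.cos (k * y) ^ p := by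
    intro y hy
    rw [hg, hf' y hy, Real.mul_rpow (by positivity) (by positivity), ← Real.rpow_mul hA0.le,
      ← Real.rpow_mul hy.le, ← Real.rpow_add_one hA0.ne']
    congr 2
    · field_simp; ring
    · rw [hp]; field_simp; ring
  have hcos : 0 < Real.cos (k * x) := by
    have hlt : |k * x| < Real.pi / 2 := by
      rw [abs_mul, abs_of_pos hk0]
      calc k * |x| < k * ((n + 1) * Real.pi / n) := by gcongr
        _ = Real.pi / 2 := by rw [hk]; field_simp
    exact Real.cos_pos_of_mem_Ioo (abs_lt.mp hlt)
  have hev : g =ᶠ[nhds x] fun y => A ^ (1 / n) * A * Real.cos (k * y) ^ p :=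
    ((by fun_prop : Continuous fun y : ℝ => Real.cos (k * y)).continuousAt.eventually
      (lt_mem_nhds hcos)).mono hg'
  have hcoef : A * (k * (p - 1)) = 1 / n := by
    rw [hA, hk, hp]; field_simp; ring
  rw [hev.deriv.deriv_eq, hg' x hcos, hf' x hcos,
    deriv_deriv_const_mul_cos_rpow_add_self hpk hcos]
  linear_combination A ^ (1 / n) * Real.cos (k * x) ^ (p - 2) * hcoef
end

section
/- Let n > 0 and T ∈ ℝ. Let f̃ : ℝ → ℝ be nonnegative with h := f̃^{n+1} twice differentiable on ℝ, and define u(x,t) = (T−t)^{−2/n}·f̃(x) for t < T. Then u satisfies the quasilinear wave equation ∂²u/∂t² (x,t) = ∂²/∂x²(u^{n+1})(x,t) + u(x,t)^{n+1} for all x ∈ ℝ and t < T if and only if f̃ satisfies the ODE (2/n)·(2/n + 1)·f̃(x) = h''(x) + h(x) for all x ∈ ℝ. -/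
/-- First derivative of a real power of `T - t`, for `t < T`. -/
theorem hasDerivAt_rpow_const_sub (T a c : ℝ) {t : ℝ} (ht : t < T) :
    HasDerivAt (fun s => (T - s) ^ a * c) (-a * (T - t) ^ (a - 1) * c) t := by
  have h₁ : HasDerivAt (fun s : ℝ => T - s) (-1) t := by
    simpa using (hasDerivAt_id t).const_sub T
  have h₂ := (h₁.rpow_const (p := a) (Or.inl (sub_pos.2 ht).ne')).mul_const c
  exact h₂.congr_deriv (by ring)

/-- Second derivative of a real power of `T - t`, for `t < T`. -/
theorem deriv_deriv_rpow_const_sub (T a c : ℝ) {t : ℝ} (ht : t < T) :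
    deriv (deriv fun s => (T - s) ^ a * c) t = a * (a - 1) * (T - t) ^ (a - 2) * c := by
  have h₁ : deriv (fun s => (T - s) ^ a * c) =ᶠ[nhds t]
      fun s => (T - s) ^ (a - 1) * (-a * c) := by
    filter_upwards [eventually_lt_nhds ht] with s hs
    rw [(hasDerivAt_rpow_const_sub T a c hs).deriv]
    ring
  rw [h₁.deriv_eq, (hasDerivAt_rpow_const_sub T (a - 1) (-a * c) ht).deriv,
    show a - 1 - 1 = a - 2 by ring]
  ring

/-- `u(x,t) = (T-t)^{-2/n} f̃(x)` solves the quasilinear wave equation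
`u_tt = (u^{n+1})_{xx} + u^{n+1}` on `ℝ × (-∞,T)` if and only if `f̃` satisfies
the ODE `(2/n)(2/n+1) f̃ = h'' + h` with `h = f̃^{n+1}`. -/
theorem stmt_2 (n T : ℝ) (hn : 0 < n)
    (ftilde : ℝ → ℝ) (hft : ∀ x : ℝ, 0 ≤ ftilde x)
    (h : ℝ → ℝ) (hh : ∀ x : ℝ, h x = ftilde x ^ (n + 1))
    (hdiff : Differentiable ℝ h) (hdiff2 : Differentiable ℝ (deriv h))
    (u : ℝ → ℝ → ℝ)
    (hu : ∀ x t : ℝ, u x t = (T - t) ^ (-(2 / n)) * ftilde x) :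
    (∀ x t : ℝ, t < T →
        deriv (deriv (fun s => u x s)) t
          = deriv (deriv (fun y => u y t ^ (n + 1))) x + u x t ^ (n + 1))
      ↔ (∀ x : ℝ, (2 / n) * (2 / n + 1) * ftilde x = deriv (deriv h) x + h x) := by
  have hspace : ∀ t : ℝ, t < T → ∀ y : ℝ,
      u y t ^ (n + 1) = (T - t) ^ (-(2 / n) - 2) * h y := by
    intro t ht y
    have hpos : 0 ≤ T - t := (sub_pos.2 ht).le
    rw [hu, hh, Real.mul_rpow (Real.rpow_nonneg hpos _) (hft y), ← Real.rpow_mul hpos,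
      show -(2 / n) * (n + 1) = -(2 / n) - 2 by field_simp; ring]
  have hequiv : ∀ x t : ℝ, t < T →
      (deriv (deriv (fun s => u x s)) t
          = deriv (deriv (fun y => u y t ^ (n + 1))) x + u x t ^ (n + 1)
        ↔ (2 / n) * (2 / n + 1) * ftilde x = deriv (deriv h) x + h x) := by
    intro x t ht
    have hxx : deriv (deriv (fun y => u y t ^ (n + 1))) x
        = (T - t) ^ (-(2 / n) - 2) * deriv (deriv h) x := by
      have hx : deriv (fun y => u y t ^ (n + 1))
          = fun y => (T - t) ^ (-(2 / n) - 2) * deriv h y := by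
        funext y
        rw [funext (hspace t ht), deriv_const_mul _ (hdiff y)]
      rw [hx, deriv_const_mul _ (hdiff2 x)]
    rw [hxx, hspace t ht x, funext (hu x), deriv_deriv_rpow_const_sub T _ _ ht, ← mul_add,
      ← mul_right_inj' (Real.rpow_pos_of_pos (sub_pos.2 ht) (-(2 / n) - 2)).ne'
        (b := (2 / n) * (2 / n + 1) * ftilde x)]
    ring_nf
  constructor
  · intro H x
    exact (hequiv x (T - 1) (by linarith)).1 (H x (T - 1) (by linarith))
  · intro H x t ht
    exact (hequiv x t ht).2 (H x)
end

section
/- Let n > 0, let m ≥ 1 be an integer, and let T ∈ ℝ. Define ψ(w) := |w|^{−n/(n+1)}·w for w ∈ ℝ (with ψ(0) = 0). Let F : ℝ → ℝ be 2m-times differentiable and satisfy (−1)^{m+1}·F^{(2m)}(x) + F(x) = (1/n)·ψ(F(x)) for all x ∈ ℝ. Set B = (2(n+2)/n)^{(n+1)/n} and define v(x,t) = (T−t)^{−2(n+1)/n}·B·F(x) for t < T. Then for all x ∈ ℝ and t < T, ∂²/∂t² [ψ(v(x,t))] = (−1)^{m+1}·∂^{2m}/∂x^{2m} v(x,t) +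 v(x,t); that is, v is a separate-variables blow-up solution of the transformed 2m-th order hyperbolic equation (ψ(v))_{tt} = (−1)^{m+1} v^{(2m)}_x + v. -/
theorem hasDerivAt_const_sub_rpow (T p : ℝ) {s : ℝ} (hs : s < T) :
    HasDerivAt (fun r : ℝ => (T - r) ^ p) (-p * (T - s) ^ (p - 1)) s := by
  have h := ((hasDerivAt_id s).const_sub T).rpow_const (p := p) (Or.inl (sub_pos.2 hs).ne')
  simpa using h

theorem deriv_deriv_const_sub_rpow_mul (T p K : ℝ) {t : ℝ} (ht : t < T) :
    deriv (deriv fun s : ℝ => (T - s) ^ p * K) t = p * (p - 1) * (T - t) ^ (p - 2) * K := by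
  have h : deriv (fun s : ℝ => (T - s) ^ p * K) =ᶠ[nhds t]
      fun s => (T - s) ^ (p - 1) * (-p * K) := by
    filter_upwards [eventually_lt_nhds ht] with s hs
    rw [((hasDerivAt_const_sub_rpow T p hs).mul_const K).deriv]
    ring
  rw [h.deriv_eq, ((hasDerivAt_const_sub_rpow T (p - 1) ht).mul_const (-p * K)).deriv,
    show p - 1 - 1 = p - 2 by ring]
  ring

/-- Separate-variables blow-up solution of the transformed `2m`-th order hyperbolic
equation `(ψ(v))_tt = (-1)^{m+1} v^{(2m)} + v`, where `ψ(w) = |w|^{-n/(n+1)} w`: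
if `(-1)^{m+1} F^{(2m)} + F = (1/n) ψ(F)` then, with `B = (2(n+2)/n)^{(n+1)/n}`,
`v(x,t) = (T-t)^{-2(n+1)/n} B F(x)` solves the PDE for `t < T`. -/
theorem stmt_6 (n : ℝ) (hn : 0 < n) (m : ℕ) (hm : 1 ≤ m) (T : ℝ)
    (ψ : ℝ → ℝ) (hψ : ∀ w : ℝ, ψ w = |w| ^ (-(n / (n + 1))) * w)
    (F : ℝ → ℝ) (hF : ContDiff ℝ (2 * m) F)
    (hode : ∀ x : ℝ,
      (-1 : ℝ) ^ (m + 1) * iteratedDeriv (2 * m) F x + F x = (1 / n) * ψ (F x))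
    (B : ℝ) (hB : B = (2 * (n + 2) / n) ^ ((n + 1) / n))
    (v : ℝ → ℝ → ℝ)
    (hv : ∀ x t : ℝ, v x t = (T - t) ^ (-(2 * (n + 1) / n)) * B * F x) :
    ∀ x t : ℝ, t < T →
      deriv (deriv (fun s => ψ (v x s))) t
        = (-1 : ℝ) ^ (m + 1) * iteratedDeriv (2 * m) (fun y => v y t) x + v x t := by
  intro x t ht
  have hn1 : n + 1 ≠ 0 := by positivity
  have hC : 0 < 2 * (n + 2) / n := by positivity
  have hB0 : 0 < B := hB ▸ Real.rpow_pos_of_pos hC _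
  have hψv : (fun s => ψ (v x s)) =ᶠ[nhds t]
      fun s => (T - s) ^ (-(2 / n)) * ((2 * (n + 2) / n) ^ (1 / n) * ψ (F x)) := by
    filter_upwards [eventually_lt_nhds ht] with s hs
    have hs0 : 0 < T - s := sub_pos.2 hs
    have hA : 0 < (T - s) ^ (-(2 * (n + 1) / n)) := Real.rpow_pos_of_pos hs0 _
    have homog {a : ℝ} (ha : 0 < a) : a ^ (-(n / (n + 1))) * a = a ^ (1 / (n + 1)) := by
      rw [← Real.rpow_add_one ha.ne']
      congr 1
      field_simp
      ring
    have hApow : ((T - s) ^ (-(2 * (n + 1) / n))) ^ (1 / (n + 1)) = (T - s) ^ (-(2 / n)) := by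
      rw [← Real.rpow_mul hs0.le]
      congr 1
      field_simp
    have hBpow : B ^ (1 / (n + 1)) = (2 * (n + 2) / n) ^ (1 / n) := by
      rw [hB, ← Real.rpow_mul hC.le]
      congr 1
      field_simp
    rw [hψ, hψ, hv, abs_mul, abs_mul, abs_of_pos hA, abs_of_pos hB0,
      Real.mul_rpow (by positivity) (abs_nonneg _), Real.mul_rpow hA.le hB0.le,
      ← hApow, ← hBpow, ← homog hA, ← homog hB0]
    ring
  have hBC : B = (2 * (n + 2) / n) ^ (1 / n) * (2 * (n + 2) / n) := by
    rw [hB, ← Real.rpow_add_one hC.ne']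
    congr 1
    field_simp
    ring
  have hexp : -(2 / n) - 2 = -(2 * (n + 1) / n) := by
    field_simp
    ring
  have hiter : iteratedDeriv (2 * m) (fun y => v y t) x
      = (T - t) ^ (-(2 * (n + 1) / n)) * B * iteratedDeriv (2 * m) F x := by
    simp only [hv]
    exact iteratedDeriv_const_mul_field _ _
  have hrhs : (-1 : ℝ) ^ (m + 1) * iteratedDeriv (2 * m) (fun y => v y t) x + v x t
      = (T - t) ^ (-(2 * (n + 1) / n)) * B * (1 / n * ψ (F x)) := by
    rw [hiter, hv, ← hode x]
    ring
  rw [hψv.deriv.deriv_eq, deriv_deriv_const_sub_rpow_mul T _ _ ht, hrhs, hexp, hBC]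
  field_simp
  ring
end

section
/- Let n > 0 and let m ≥ 1 be an integer. Set α = n/(n+1) and γ = 2m(n+1)/n, and let φ : ℝ → ℝ be 2m-times continuously differentiable. Define F(y) = y^{γ}·φ(ln y) for y > 0. Then F satisfies F^{(2m)}(y) = (−1)^{m+1}·|F(y)|^{−α}·F(y) + (−1)^{m}·F(y) for all y > 0 if and only if the oscillatory component φ satisfies (P_{2m}(φ))(s) = (−1)^{m+1}·|φ(s)|^{−α}·φ(s) + (−1)^{m}·e^{2ms}·φ(s) for all s ∈ ℝ. -/
/-- The operators `P_k` defined by `P₀(φ) = φ`,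
`P_{k+1}(φ) = (P_k(φ))' + (γ - k) P_k(φ)`. -/
noncomputable def Pop (γ : ℝ) : ℕ → (ℝ → ℝ) → ℝ → ℝ
  | 0, φ => φ
  | j + 1, φ => fun s => deriv (Pop γ j φ) s + (γ - (j : ℝ)) * Pop γ j φ s

theorem Pop_contDiff (γ : ℝ) {φ : ℝ → ℝ} (i j : ℕ) (hφ : ContDiff ℝ ((i + j : ℕ) : ℕ∞) φ) :
    ContDiff ℝ (i : ℕ∞) (Pop γ j φ) := by
  induction j generalizing i with
  | zero => simpa [Pop] using hφ
  | succ j ih =>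
    have h : ContDiff ℝ ((i + 1 : ℕ) : ℕ∞) (Pop γ j φ) := by
      refine ih (i + 1) ?_
      rwa [show i + 1 + j = i + (j + 1) by ring]
    have hd : ContDiff ℝ (i : ℕ∞) (deriv (Pop γ j φ)) := by
      have h' : ContDiff ℝ ((i : WithTop ℕ∞) + 1) (Pop γ j φ) := by exact_mod_cast h
      exact (contDiff_succ_iff_deriv.mp h').2.2
    exact hd.add (contDiff_const.mul (h.of_le (by exact_mod_cast Nat.le_succ i)))

theorem iteratedDeriv_rpow_mul_comp_log (γ : ℝ) {φ F : ℝ → ℝ} (k : ℕ)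
    (hφ : ContDiff ℝ (k : ℕ∞) φ) (hF : ∀ y, F y = y ^ γ * φ (Real.log y)) {y : ℝ} (hy : 0 < y) :
    iteratedDeriv k F y = y ^ (γ - k) * Pop γ k φ (Real.log y) := by
  induction k generalizing y with
  | zero => simp [Pop, hF]
  | succ k ih =>
    have hφk : ContDiff ℝ (k : ℕ∞) φ := hφ.of_le (by exact_mod_cast Nat.le_succ k)
    have heq : iteratedDeriv k F =ᶠ[nhds y]
        fun x => x ^ (γ - k) * Pop γ k φ (Real.log x) := by
      filter_upwards [lt_mem_nhds hy] with x hx using ih hφk hx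
    have hP : ContDiff ℝ ((1 : ℕ) : ℕ∞) (Pop γ k φ) :=
      Pop_contDiff γ 1 k (by rwa [add_comm 1 k])
    have hPd : HasDerivAt (Pop γ k φ) (deriv (Pop γ k φ) (Real.log y)) (Real.log y) :=
      (hP.differentiable (by simp) _).hasDerivAt
    have hd := (Real.hasDerivAt_rpow_const (p := γ - k) (Or.inl hy.ne')).mul
      (hPd.comp y (Real.hasDerivAt_log hy.ne'))
    have hexp : y ^ (γ - k) = y ^ (γ - k - 1) * y := by
      rw [Real.rpow_sub_one hy.ne', div_mul_cancel₀ _ hy.ne']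
    rw [iteratedDeriv_succ, heq.deriv_eq]
    refine hd.deriv.trans ?_
    simp only [Pop, Function.comp_apply]
    rw [hexp, show γ - ((k + 1 : ℕ) : ℝ) = γ - k - 1 by push_cast; ring]
    field_simp
    ring

theorem abs_rpow_neg_mul_self_mul {a : ℝ} (ha : 0 < a) (α w : ℝ) :
    |a * w| ^ (-α) * (a * w) = a ^ (1 - α) * (|w| ^ (-α) * w) := by
  rw [abs_mul, abs_of_pos ha, Real.mul_rpow ha.le (abs_nonneg w), sub_eq_neg_add,
    Real.rpow_add_one ha.ne']
  ring

/-- Transformation `F(y) = y^γ φ(ln y)`, `γ = 2m(n+1)/n`, of the profile ODE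
`F^{(2m)} = (-1)^{m+1} |F|^{-α} F + (-1)^m F` near the interface to the
exponentially perturbed autonomous equation
`P_{2m}(φ) = (-1)^{m+1} |φ|^{-α} φ + (-1)^m e^{2ms} φ` for the oscillatory
component. -/
theorem stmt_12 (n : ℝ) (hn : 0 < n) (m : ℕ) (hm : 1 ≤ m)
    (α γ : ℝ) (hα : α = n / (n + 1)) (hγ : γ = 2 * m * (n + 1) / n)
    (φ : ℝ → ℝ) (hφ : ContDiff ℝ (2 * m) φ)
    (F : ℝ → ℝ) (hF : ∀ y : ℝ, F y = y ^ γ * φ (Real.log y)) :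
    (∀ y : ℝ, 0 < y →
        iteratedDeriv (2 * m) F y
          = (-1 : ℝ) ^ (m + 1) * (|F y| ^ (-α) * F y) + (-1 : ℝ) ^ m * F y)
      ↔ (∀ s : ℝ,
        Pop γ (2 * m) φ s
          = (-1 : ℝ) ^ (m + 1) * (|φ s| ^ (-α) * φ s)
            + (-1 : ℝ) ^ m * Real.exp (2 * m * s) * φ s) := by
  have hn1 : n + 1 ≠ 0 := by positivity
  have hγα : γ * (1 - α) = γ - (2 * m : ℕ) := by
    rw [hα, hγ]
    push_cast
    field_simp
  have key : ∀ s : ℝ,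
      (iteratedDeriv (2 * m) F (Real.exp s)
          = (-1 : ℝ) ^ (m + 1) * (|F (Real.exp s)| ^ (-α) * F (Real.exp s))
            + (-1 : ℝ) ^ m * F (Real.exp s)) ↔
        Pop γ (2 * m) φ s
          = (-1 : ℝ) ^ (m + 1) * (|φ s| ^ (-α) * φ s)
            + (-1 : ℝ) ^ m * Real.exp (2 * m * s) * φ s := by
    intro s
    have hs := Real.exp_pos s
    have hpow : Real.exp s ^ γ = Real.exp s ^ (γ - (2 * m : ℕ)) * Real.exp (2 * m * s) := by
      rw [← Real.exp_mul, ← Real.exp_mul, ← Real.exp_add]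
      congr 1
      push_cast
      ring
    rw [iteratedDeriv_rpow_mul_comp_log γ (2 * m) (by exact_mod_cast hφ) hF hs, hF,
      Real.log_exp, abs_rpow_neg_mul_self_mul (Real.rpow_pos_of_pos hs γ),
      ← Real.rpow_mul hs.le, hγα, hpow]
    conv_rhs => rw [← mul_right_inj' (Real.rpow_pos_of_pos hs (γ - (2 * m : ℕ))).ne']
    ring_nf
  refine ⟨fun h s => (key s).mp (h _ (Real.exp_pos s)), fun h y hy => ?_⟩
  have := (key (Real.log y)).mpr (h _)
  rwa [Real.exp_log hy] at this
end
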